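/- arXiv:2509.05706 — 4 statements merged into one kernel-verified Lean document; each statement's English description precedes it below -/
import Mathlib

section
/- Under the dissipativity assumption, for all ε > 0, all y, y' ∈ ℝ and all z ∈ ℝ^d, one has a^ε(y,y',z) + 2G((c^{ij,ε}(y,y',z))_{i,j=1}^d) ≤ −μ. -/
/-- The cut-off function `l^ε(x,x') = 1` if `|x−x'| ≥ ε` and `|x−x'|/ε` otherwise. -/
noncomputable def lEps (ε x x' : ℝ) : ℝ :=
  if ε ≤ |x - x'| then 1 else |x - x'| / ε

/-- The linearization coefficient
`a^ε(y,y',z) = l^ε(y,y')·(h(y,z)−h(y',z))/(y−y') − κ(1−l^ε(y,y'))` for `y ≠ y'`,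
and `a^ε(y,y,z) = −κ` (applied to `h = f` it gives `a^ε`, applied to `h = g^{ij}`
it gives `c^{ij,ε}`). -/
noncomputable def aEps {d : ℕ} (h : ℝ → EuclideanSpace ℝ (Fin d) → ℝ)
    (κ ε : ℝ) (y y' : ℝ) (z : EuclideanSpace ℝ (Fin d)) : ℝ :=
  if y = y' then -κ
  else lEps ε y y' * ((h y z - h y' z) / (y - y')) - κ * (1 - lEps ε y y')

/-- The `d × d` matrix `J_d` all of whose entries equal `1`. -/
def Jmat (d : ℕ) : Matrix (Fin d) (Fin d) ℝ :=
  Matrix.of fun _ _ => 1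

/-- under the dissipativity assumption,
`a^ε(y,y',z) + 2G((c^{ij,ε}(y,y',z))_{ij}) ≤ −μ`. -/
theorem stmt10 (d : ℕ) (hd : 1 ≤ d) (Ly Lz : ℝ) (hLy : 0 < Ly) (hLz : 0 < Lz)
    (G : Matrix (Fin d) (Fin d) ℝ → ℝ)
    (hGsub : ∀ A B : Matrix (Fin d) (Fin d) ℝ, A.IsSymm → B.IsSymm →
      G (A + B) ≤ G A + G B)
    (hGhom : ∀ (l : ℝ) (A : Matrix (Fin d) (Fin d) ℝ), 0 ≤ l → A.IsSymm →
      G (l • A) = l * G A)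
    (hGJ : 2 * G (-(Jmat d)) < 1)
    (f : ℝ → EuclideanSpace ℝ (Fin d) → ℝ)
    (g : Fin d → Fin d → ℝ → EuclideanSpace ℝ (Fin d) → ℝ)
    (hgsymm : ∀ i j, g i j = g j i)
    (μ : ℝ) (hμ : 0 < μ) (hμLy : μ ≤ (1 - 2 * G (-(Jmat d))) * Ly)
    (hdiss : ∀ (y y' : ℝ) (z : EuclideanSpace ℝ (Fin d)),
      (y - y') * (f y z - f y' z) +
        2 * G (Matrix.of fun i j => (y - y') * (g i j y z - g i j y' z)) ≤
        -μ * |y - y'| ^ 2)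
    (κ : ℝ) (hκ : κ = μ / (1 - 2 * G (-(Jmat d))))
    (ε : ℝ) (hε : 0 < ε) :
    ∀ (y y' : ℝ) (z : EuclideanSpace ℝ (Fin d)),
      aEps f κ ε y y' z + 2 * G (Matrix.of fun i j => aEps (g i j) κ ε y y' z) ≤ -μ := by
  intro y y' z
  have hpos : 0 < 1 - 2 * G (-(Jmat d)) := by linarith
  have hκμ : κ * (1 - 2 * G (-(Jmat d))) = μ := by
    rw [hκ]; field_simp
  have hκ0 : 0 ≤ κ := by rw [hκ]; positivity
  have hJ : (-(Jmat d)).IsSymm := by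
    ext i j; simp [Jmat]
  by_cases hy : y = y'
  · have hM : (Matrix.of fun i j => aEps (g i j) κ ε y y' z) = κ • (-(Jmat d)) := by
      ext i j; simp [aEps, hy, Jmat]
    rw [hM, hGhom κ _ hκ0 hJ]
    simp only [aEps, hy, if_true]
    linarith
  · have hδ : y - y' ≠ 0 := sub_ne_zero.mpr hy
    have hl0 : 0 ≤ lEps ε y y' := by
      unfold lEps; split_ifs <;> positivity
    have hl1 : lEps ε y y' ≤ 1 := by
      unfold lEps; split_ifs with h
      · exact le_refl _
      · rw [div_le_one hε]; linarith
    have hD := hdiss y y' z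
    set D : Matrix (Fin d) (Fin d) ℝ :=
      Matrix.of fun i j => (y - y') * (g i j y z - g i j y' z) with hDdef
    have hDs : D.IsSymm := by
      ext i j; simp [hDdef, hgsymm i j]
    generalize hl : lEps ε y y' = l at *
    have hM : (Matrix.of fun i j => aEps (g i j) κ ε y y' z)
        = (l / (y - y') ^ 2) • D + (κ * (1 - l)) • (-(Jmat d)) := by
      ext i j
      simp only [aEps, hy, if_false, hl, Jmat, hDdef, Matrix.of_apply, Matrix.add_apply,
        Matrix.smul_apply, Matrix.neg_apply, smul_eq_mul]
      field_simp
      ring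
    have hc : 0 ≤ l / (y - y') ^ 2 := by positivity
    have hk : 0 ≤ κ * (1 - l) := mul_nonneg hκ0 (by linarith)
    have hs := hGsub _ _ (hDs.smul (l / (y - y') ^ 2)) (hJ.smul (κ * (1 - l)))
    rw [hGhom _ _ hc hDs, hGhom _ _ hk hJ] at hs
    rw [hM]
    have hm := mul_le_mul_of_nonneg_left hD hc
    rw [sq_abs] at hm
    have e1 : l / (y - y') ^ 2 * (-μ * (y - y') ^ 2) = -(l * μ) := by
      field_simp
    have e2 : l / (y - y') ^ 2 * ((y - y') * (f y z - f y' z) + 2 * G D)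
        = l * ((f y z - f y' z) / (y - y')) + 2 * (l / (y - y') ^ 2 * G D) := by
      field_simp
    rw [e1, e2] at hm
    simp only [aEps, hy, if_false, hl]
    have e3 : (1 - l) * (κ * (1 - 2 * G (-(Jmat d)))) = (1 - l) * μ := by rw [hκμ]
    linarith
end

section
/- For all ε > 0, every integer n ≥ 1, all y, y' ∈ ℝ and all z, z̃ ∈ ℝ^d, one has |a^{ε,n}(y,y',z) − a^{ε,n}(y,y',z̃)| ≤ (2L_z(1 + 2n)/ε)·|z − z̃|. -/
open Classical

/-- The truncation `f_n(y,z) = f(y, (min(|z|,n)/|z|)·z)` (and `f_n(y,0) = f(y,0)`). -/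
noncomputable def fTrunc {d : ℕ} (f : ℝ → EuclideanSpace ℝ (Fin d) → ℝ) (n : ℕ)
    (y : ℝ) (z : EuclideanSpace ℝ (Fin d)) : ℝ :=
  if z = 0 then f y 0 else f y ((min ‖z‖ (n : ℝ) / ‖z‖) • z)

/-- Radial projection on the closed ball of radius `n`. -/
noncomputable def radP {d : ℕ} (n : ℕ) (z : EuclideanSpace ℝ (Fin d)) :
    EuclideanSpace ℝ (Fin d) := (min ‖z‖ (n : ℝ) / ‖z‖) • z

lemma fTrunc_eq_radP {d : ℕ} (f : ℝ → EuclideanSpace ℝ (Fin d) → ℝ) (n : ℕ)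
    (y : ℝ) (z : EuclideanSpace ℝ (Fin d)) : fTrunc f n y z = f y (radP n z) := by
  unfold fTrunc radP
  split_ifs with h
  · simp [h]
  · rfl

lemma radP_norm {d : ℕ} (n : ℕ) (z : EuclideanSpace ℝ (Fin d)) :
    ‖radP n z‖ ≤ n := by
  unfold radP
  by_cases h : z = 0
  · simp [h]
  · have hz : 0 < ‖z‖ := norm_pos_iff.mpr h
    have h0 : 0 ≤ min ‖z‖ (n : ℝ) / ‖z‖ := by positivity
    rw [norm_smul, Real.norm_of_nonneg h0, div_mul_cancel₀ _ hz.ne']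
    exact min_le_right _ _

lemma radP_var {d : ℕ} (n : ℕ) (z v : EuclideanSpace ℝ (Fin d)) (hv : ‖v‖ ≤ n) :
    inner ℝ (z - radP n z) (v - radP n z) ≤ 0 := by
  by_cases h : z = 0
  · simp [h, radP]
  have hz : 0 < ‖z‖ := norm_pos_iff.mpr h
  rcases le_total ‖z‖ (n : ℝ) with hn | hn
  · have : radP n z = z := by
      unfold radP
      rw [min_eq_left hn, div_self hz.ne', one_smul]
    simp [this]
  · have e : radP n z = ((n : ℝ) / ‖z‖) • z := by
      unfold radP
      rw [min_eq_right hn]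
    have e1 : z - radP n z = (1 - (n : ℝ) / ‖z‖) • z := by
      rw [e, sub_smul, one_smul]
    have h1 : (n : ℝ) / ‖z‖ ≤ 1 := (div_le_one hz).mpr hn
    rw [e1, real_inner_smul_left, inner_sub_right, e, real_inner_smul_right,
      real_inner_self_eq_norm_sq]
    have h2 : inner ℝ z v ≤ ‖z‖ * n :=
      (real_inner_le_norm z v).trans (by gcongr)
    have h3 : (n : ℝ) / ‖z‖ * ‖z‖ ^ 2 = ‖z‖ * n := by field_simp
    rw [h3]
    exact mul_nonpos_of_nonneg_of_nonpos (by linarith) (by linarith)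

lemma radP_lip {d : ℕ} (n : ℕ) (z w : EuclideanSpace ℝ (Fin d)) :
    ‖radP n z - radP n w‖ ≤ ‖z - w‖ := by
  have h1 := radP_var n z (radP n w) (radP_norm n w)
  have h2 := radP_var n w (radP n z) (radP_norm n z)
  have h3 := real_inner_le_norm (z - w) (radP n z - radP n w)
  have h4 : ‖radP n z - radP n w‖ ^ 2 ≤ inner ℝ (z - w) (radP n z - radP n w) := by
    rw [← real_inner_self_eq_norm_sq]
    generalize radP n z = p at *
    generalize radP n w = q at *
    simp only [inner_sub_left, inner_sub_right] at *
    linarith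
  by_contra hc
  push Not at hc
  nlinarith [norm_nonneg (z - w), norm_nonneg (radP n z - radP n w)]

lemma lEps_div_le (ε y y' : ℝ) (hε : 0 < ε) (h : y ≠ y') :
    |lEps ε y y' / (y - y')| ≤ 1 / ε := by
  have hp : 0 < |y - y'| := abs_pos.mpr (sub_ne_zero.mpr h)
  unfold lEps
  rw [abs_div]
  split_ifs with hc
  · rw [abs_one]
    exact one_div_le_one_div_of_le hε hc
  · rw [abs_div, abs_abs, abs_of_pos hε]
    apply le_of_eq
    field_simp

/-- `a^{ε,n} := a^ε` built from `f_n` satisfies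
`|a^{ε,n}(y,y',z) − a^{ε,n}(y,y',z̃)| ≤ (2L_z(1+2n)/ε)·|z − z̃|`. -/
theorem stmt13 (d : ℕ) (hd : 1 ≤ d) (Ly Lz : ℝ) (hLy : 0 < Ly) (hLz : 0 < Lz)
    (f : ℝ → EuclideanSpace ℝ (Fin d) → ℝ)
    (hf : ∀ (y y' : ℝ) (z z' : EuclideanSpace ℝ (Fin d)),
      |f y z - f y' z'| ≤ Ly * |y - y'| + Lz * (1 + ‖z‖ + ‖z'‖) * ‖z - z'‖)
    (κ : ℝ) (hκ : 0 < κ) (hκLy : κ ≤ Ly) (ε : ℝ) (hε : 0 < ε) :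
    ∀ n : ℕ, 1 ≤ n → ∀ (y y' : ℝ) (z zt : EuclideanSpace ℝ (Fin d)),
      |aEps (fTrunc f n) κ ε y y' z - aEps (fTrunc f n) κ ε y y' zt| ≤
        2 * Lz * (1 + 2 * (n : ℝ)) / ε * ‖z - zt‖ := by
  intro n _ y y' z zt
  by_cases hy : y = y'
  · simp only [aEps, hy, if_true, sub_self, abs_zero]
    positivity
  have key : ∀ x : ℝ, |fTrunc f n x z - fTrunc f n x zt| ≤ Lz * (1 + 2 * (n : ℝ)) * ‖z - zt‖ := by
    intro x
    rw [fTrunc_eq_radP, fTrunc_eq_radP]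
    refine (hf x x _ _).trans ?_
    rw [sub_self, abs_zero, mul_zero, zero_add]
    have h1 := radP_norm n z
    have h2 := radP_norm n zt
    exact mul_le_mul (mul_le_mul_of_nonneg_left (by linarith) hLz.le) (radP_lip n z zt)
      (norm_nonneg _) (by positivity)
  have e : aEps (fTrunc f n) κ ε y y' z - aEps (fTrunc f n) κ ε y y' zt =
      lEps ε y y' / (y - y') * ((fTrunc f n y z - fTrunc f n y zt)
        - (fTrunc f n y' z - fTrunc f n y' zt)) := by
    simp only [aEps, hy, if_false]
    ring
  rw [e, abs_mul]
  have h3 : |(fTrunc f n y z - fTrunc f n y zt) - (fTrunc f n y' z - fTrunc f n y' zt)|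
      ≤ 2 * (Lz * (1 + 2 * (n : ℝ)) * ‖z - zt‖) := by
    refine (abs_sub _ _).trans ?_
    linarith [key y, key y']
  calc _ ≤ 1 / ε * (2 * (Lz * (1 + 2 * (n : ℝ)) * ‖z - zt‖)) :=
        mul_le_mul (lEps_div_le ε y y' hε hy) h3 (abs_nonneg _) (by positivity)
    _ = _ := by ring
end

section
/- For all ε > 0, every integer n ≥ 1 and all z ∈ ℝ^d: (a) |a^{ε,n}(y,y',z) − a^{ε,n}(ỹ,y',z)| ≤ (4L_y/ε)·|y − ỹ| for all y, ỹ, y' ∈ ℝ; and (b) |a^{ε,n}(y,y',z) − a^{ε,n}(y,ỹ',z)| ≤ (4L_y/ε)·|y' − ỹ'| for all y, y', ỹ' ∈ ℝ. -/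
open Classical

theorem aEps_eq_aux {d : ℕ} (h : ℝ → EuclideanSpace ℝ (Fin d) → ℝ) (κ ε y y' : ℝ)
    (z : EuclideanSpace ℝ (Fin d)) (hε : 0 < ε) :
    aEps h κ ε y y' z = (if y' ≤ y then h y z - h y' z + κ * (y - y')
      else -(h y z - h y' z + κ * (y - y'))) / max |y - y'| ε - κ := by
  unfold aEps lEps
  by_cases e : y = y'
  · subst e; simp
  have hne : y - y' ≠ 0 := sub_ne_zero.mpr e
  rw [if_neg e]
  by_cases h1 : y' ≤ y
  · have ha : |y - y'| = y - y' := abs_of_nonneg (by linarith)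
    rw [if_pos h1, ha]
    split_ifs with h2
    · rw [max_eq_left h2]; field_simp; ring
    · rw [max_eq_right (by linarith)]; field_simp; ring
  · have ha : |y - y'| = -(y - y') := abs_of_nonpos (by linarith)
    rw [if_neg h1, ha]
    split_ifs with h2
    · rw [max_eq_left h2]; field_simp; ring
    · rw [max_eq_right (by linarith)]; field_simp; ring

theorem aEps_symm_aux {d : ℕ} (h : ℝ → EuclideanSpace ℝ (Fin d) → ℝ) (κ ε y y' : ℝ)
    (z : EuclideanSpace ℝ (Fin d)) : aEps h κ ε y y' z = aEps h κ ε y' y z := by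
  unfold aEps lEps
  rw [abs_sub_comm y y', ← neg_sub (h y' z) (h y z), ← neg_sub y' y, neg_div_neg_eq]
  simp only [eq_comm]

theorem aEps_lip_aux {d : ℕ} (h : ℝ → EuclideanSpace ℝ (Fin d) → ℝ) (κ ε L : ℝ)
    (z : EuclideanSpace ℝ (Fin d)) (hε : 0 < ε) (hκ : 0 < κ) (hκL : κ ≤ L)
    (hh : ∀ y y', |h y z - h y' z| ≤ L * |y - y'|) (y yt y' : ℝ) :
    |aEps h κ ε y y' z - aEps h κ ε yt y' z| ≤ 4 * L / ε * |y - yt| := by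
  rw [aEps_eq_aux h κ ε y y' z hε, aEps_eq_aux h κ ε yt y' z hε]
  have hF : ∀ a b, |h a z - h b z + κ * (a - b)| ≤ 2 * L * |a - b| := by
    intro a b
    have h1 := abs_add_le (h a z - h b z) (κ * (a - b))
    rw [abs_mul, abs_of_pos hκ] at h1
    nlinarith [hh a b, mul_le_mul_of_nonneg_right hκL (abs_nonneg (a - b))]
  set G : ℝ → ℝ := fun y => (if y' ≤ y then h y z - h y' z + κ * (y - y')
      else -(h y z - h y' z + κ * (y - y'))) with hG
  have hG0 : |G yt| ≤ 2 * L * |yt - y'| := by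
    simp only [hG]
    split_ifs
    · exact hF _ _
    · rw [abs_neg]; exact hF _ _
  have hGL : |G y - G yt| ≤ 2 * L * |y - yt| := by
    have e1 := abs_le.1 (hF y y')
    have e2 := abs_le.1 (hF yt y')
    have e3 := abs_le.1 (hF y yt)
    simp only [hG]
    split_ifs with c1 c2 c2
    · rw [abs_le]; constructor <;> linarith
    · rw [abs_of_nonneg (show 0 ≤ y - y' by linarith)] at e1
      rw [abs_of_nonpos (show yt - y' ≤ 0 by linarith)] at e2
      rw [abs_of_nonneg (show 0 ≤ y - yt by linarith), abs_le]
      constructor <;> linarith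
    · rw [abs_of_nonpos (show y - y' ≤ 0 by linarith)] at e1
      rw [abs_of_nonneg (show 0 ≤ yt - y' by linarith)] at e2
      rw [abs_of_nonpos (show y - yt ≤ 0 by linarith), abs_le]
      constructor <;> linarith
    · rw [abs_le]; constructor <;> linarith
  change |G y / max |y - y'| ε - κ - (G yt / max |yt - y'| ε - κ)| ≤ _
  have hM : |max |yt - y'| ε - max |y - y'| ε| ≤ |y - yt| := by
    refine (abs_max_sub_max_le_abs _ _ _).trans ((abs_abs_sub_abs_le _ _).trans ?_)
    rw [abs_sub_comm y yt]; simp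
  have hm1 : ε ≤ max |y - y'| ε := le_max_right _ _
  have hm2 : ε ≤ max |yt - y'| ε := le_max_right _ _
  have hm3 : |yt - y'| ≤ max |yt - y'| ε := le_max_left _ _
  generalize max |y - y'| ε = M at *
  generalize max |yt - y'| ε = N at *
  have hMp : 0 < M := by linarith
  have hNp : 0 < N := by linarith
  have hL : 0 < L := by linarith
  have key : G y / M - κ - (G yt / N - κ) = ((G y - G yt) + G yt / N * (N - M)) / M := by
    field_simp; ring
  have hq : |G yt / N| ≤ 2 * L := by
    rw [abs_div, abs_of_pos hNp, div_le_iff₀ hNp]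
    exact hG0.trans (by gcongr)
  rw [key, abs_div, abs_of_pos hMp]
  have hnum : |(G y - G yt) + G yt / N * (N - M)| ≤ 4 * L * |y - yt| := by
    refine (abs_add_le _ _).trans ?_
    rw [abs_mul]
    have := mul_le_mul hq hM (abs_nonneg _) (by linarith)
    linarith
  calc _ ≤ 4 * L * |y - yt| / ε := by gcongr
    _ = _ := by ring

/-- `a^{ε,n} := a^ε` built from `f_n` is `(4L_y/ε)`-Lipschitz in each
of its first two (real) arguments. -/
theorem stmt14 (d : ℕ) (hd : 1 ≤ d) (Ly Lz : ℝ) (hLy : 0 < Ly) (hLz : 0 < Lz)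
    (f : ℝ → EuclideanSpace ℝ (Fin d) → ℝ)
    (hf : ∀ (y y' : ℝ) (z z' : EuclideanSpace ℝ (Fin d)),
      |f y z - f y' z'| ≤ Ly * |y - y'| + Lz * (1 + ‖z‖ + ‖z'‖) * ‖z - z'‖)
    (κ : ℝ) (hκ : 0 < κ) (hκLy : κ ≤ Ly) (ε : ℝ) (hε : 0 < ε) :
    ∀ n : ℕ, 1 ≤ n → ∀ z : EuclideanSpace ℝ (Fin d),
      (∀ y yt y' : ℝ,
        |aEps (fTrunc f n) κ ε y y' z - aEps (fTrunc f n) κ ε yt y' z| ≤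
          4 * Ly / ε * |y - yt|) ∧
      (∀ y y' yt' : ℝ,
        |aEps (fTrunc f n) κ ε y y' z - aEps (fTrunc f n) κ ε y yt' z| ≤
          4 * Ly / ε * |y' - yt'|) := by
  intro n _ z
  have hh : ∀ y y', |fTrunc f n y z - fTrunc f n y' z| ≤ Ly * |y - y'| := by
    intro y y'
    unfold fTrunc
    split_ifs
    · simpa using hf y y' 0 0
    · simpa using hf y y' ((min ‖z‖ (n : ℝ) / ‖z‖) • z) ((min ‖z‖ (n : ℝ) / ‖z‖) • z)
  have key := aEps_lip_aux (fTrunc f n) κ ε Ly z hε hκ hκLy hh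
  refine ⟨key, fun y y' yt' => ?_⟩
  rw [aEps_symm_aux _ κ ε y y', aEps_symm_aux _ κ ε y yt']
  exact key y' yt' y
end

section
/- For all ε > 0, every integer n ≥ 1, all y, y' ∈ ℝ and all z ∈ ℝ^d, one has |a^ε(y,y',z) − a^{ε,n}(y,y',z)| ≤ (4L_z/ε)·|z|²·1_{|z|>n}, where 1_{|z|>n} equals 1 if |z| > n and 0 otherwise. -/
open Classical

/-- `|a^ε(y,y',z) − a^{ε,n}(y,y',z)| ≤ (4L_z/ε)·|z|²·1_{|z|>n}`. -/
theorem stmt15 (d : ℕ) (hd : 1 ≤ d) (Ly Lz : ℝ) (hLy : 0 < Ly) (hLz : 0 < Lz)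
    (f : ℝ → EuclideanSpace ℝ (Fin d) → ℝ)
    (hf : ∀ (y y' : ℝ) (z z' : EuclideanSpace ℝ (Fin d)),
      |f y z - f y' z'| ≤ Ly * |y - y'| + Lz * (1 + ‖z‖ + ‖z'‖) * ‖z - z'‖)
    (κ : ℝ) (hκ : 0 < κ) (hκLy : κ ≤ Ly) (ε : ℝ) (hε : 0 < ε) :
    ∀ n : ℕ, 1 ≤ n → ∀ (y y' : ℝ) (z : EuclideanSpace ℝ (Fin d)),
      |aEps f κ ε y y' z - aEps (fTrunc f n) κ ε y y' z| ≤
        4 * Lz / ε * ‖z‖ ^ 2 * (if (n : ℝ) < ‖z‖ then 1 else 0) := by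
  intro n hn y y' z
  have hn1 : (1 : ℝ) ≤ n := by exact_mod_cast hn
  by_cases hz : (n : ℝ) < ‖z‖
  · have hr : 0 < ‖z‖ := by linarith
    have hz0 : z ≠ 0 := norm_pos_iff.mp hr
    rw [if_pos hz, mul_one]
    by_cases hy : y = y'
    · simp only [aEps, if_pos hy, sub_self, abs_zero]
      positivity
    · have hd0 : 0 < |y - y'| := abs_pos.mpr (sub_ne_zero.mpr hy)
      have hl0 : 0 ≤ lEps ε y y' := by
        unfold lEps
        split_ifs <;> positivity
      have hl : lEps ε y y' / |y - y'| ≤ 1 / ε := by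
        unfold lEps
        split_ifs with h
        · exact one_div_le_one_div_of_le hε h
        · apply le_of_eq
          field_simp
      have hw : ‖((n : ℝ) / ‖z‖) • z‖ = n := by
        rw [norm_smul, Real.norm_of_nonneg (by positivity)]
        field_simp
      have hzw : ‖z - ((n : ℝ) / ‖z‖) • z‖ = ‖z‖ - n := by
        have h1 : z - ((n : ℝ) / ‖z‖) • z = (1 - (n : ℝ) / ‖z‖) • z := by
          rw [sub_smul, one_smul]
        have h2 : 0 ≤ 1 - (n : ℝ) / ‖z‖ := by
          rw [sub_nonneg, div_le_one hr]
          exact hz.le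
        rw [h1, norm_smul, Real.norm_of_nonneg h2]
        field_simp
      have key : ∀ u : ℝ, |f u z - fTrunc f n u z| ≤ 2 * Lz * ‖z‖ ^ 2 := by
        intro u
        have h := hf u u z (((n : ℝ) / ‖z‖) • z)
        rw [hw, hzw, sub_self, abs_zero, mul_zero, zero_add] at h
        simp only [fTrunc, if_neg hz0, min_eq_right hz.le]
        refine h.trans ?_
        have : (1 + ‖z‖ + n) * (‖z‖ - n) ≤ 2 * ‖z‖ ^ 2 := by nlinarith
        nlinarith
      have heq : aEps f κ ε y y' z - aEps (fTrunc f n) κ ε y y' z =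
          lEps ε y y' * (((f y z - fTrunc f n y z) - (f y' z - fTrunc f n y' z)) / (y - y')) := by
        simp only [aEps, if_neg hy]
        ring
      have h4 : |(f y z - fTrunc f n y z) - (f y' z - fTrunc f n y' z)| ≤ 4 * Lz * ‖z‖ ^ 2 := by
        refine (abs_sub _ _).trans ?_
        linarith [key y, key y']
      rw [heq, abs_mul, abs_div, abs_of_nonneg hl0]
      calc _ = lEps ε y y' / |y - y'| *
            |(f y z - fTrunc f n y z) - (f y' z - fTrunc f n y' z)| := by ring
        _ ≤ 1 / ε * (4 * Lz * ‖z‖ ^ 2) :=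
            mul_le_mul hl h4 (abs_nonneg _) (by positivity)
        _ = _ := by ring
  · have hE : ∀ u : ℝ, fTrunc f n u z = f u z := by
      intro u
      unfold fTrunc
      split_ifs with h0
      · rw [h0]
      · rw [min_eq_left (not_lt.mp hz), div_self (norm_ne_zero_iff.mpr h0), one_smul]
    simp [aEps, hE, hz]
end
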